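/- Let θ ∈ (0, π/2), a, b > 0, ω ≥ 0, r ≥ 0 and d ≥ 1. Let F be holomorphic on the open sector Δ(θ) = {ζ ∈ ℂ\{0} : |arg ζ| < θ} and satisfy |F(ζ)| ≤ a |ζ|^{−d/2} e^{ω|ζ|} e^{−br²/|ζ|} for all ζ ∈ Δ(θ). Then there exist constants a', b' > 0 and ω' ≥ 0, depending only on a, b, d, θ and ω (and not on r, t or t'), such that |F(t − t') − F(t)| ≤ a' |t'| t^{−1−d/2} e^{ω' t} e^{−b'r²/t} for all t > 0 and all t' ∈ ℝ with |t'| ≤ t/2. -/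

import Mathlib

open MeasureTheory Complex Real

noncomputable section

/-- The open sector `Δ(θ) = {ζ ∈ ℂ∖{0} : |arg ζ| < θ}`. -/
def sector (θ : ℝ) : Set ℂ := {ζ : ℂ | ζ ≠ 0 ∧ |Complex.arg ζ| < θ}

/-- The open disc around `s > 0` touching the boundary rays lies in the sector. -/
theorem mem_sector_of_norm_sub_lt {θ s : ℝ} (hθ₀ : 0 < θ) (hθ : θ < π / 2) (hs : 0 < s)
    {ζ : ℂ} (hζ : ‖ζ - s‖ < s * Real.sin θ) : ζ ∈ sector θ := by
  have hsin : 0 < Real.sin θ := Real.sin_pos_of_pos_of_lt_pi hθ₀ (by linarith)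
  have hcs := Real.sin_sq_add_cos_sq θ
  have hre : 0 < ζ.re := by
    have h := (abs_le.1 (Complex.abs_re_le_norm (ζ - s))).1
    simp only [Complex.sub_re, Complex.ofReal_re] at h
    nlinarith [Real.sin_le_one θ]
  have hne : ζ ≠ 0 := by
    rintro rfl
    simp at hre
  have hnorm : 0 < ‖ζ‖ := norm_pos_iff.2 hne
  have hsq : ‖ζ - s‖ ^ 2 = (ζ.re - s) ^ 2 + ζ.im ^ 2 := by
    rw [Complex.sq_norm, Complex.normSq_apply]
    simp
    ring
  have key : ∀ y : ℝ, y ^ 2 = ζ.im ^ 2 → y * Real.cos θ - ζ.re * Real.sin θ < 0 := by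
    intro y hy
    have : y * Real.cos θ - (ζ.re - s) * Real.sin θ ≤ ‖ζ - s‖ := by
      apply le_of_sq_le_sq _ (norm_nonneg _)
      rw [hsq, ← hy]
      have : (ζ.re - s) ^ 2 + y ^ 2
          = ((ζ.re - s) ^ 2 + y ^ 2) * (Real.sin θ ^ 2 + Real.cos θ ^ 2) := by rw [hcs, mul_one]
      rw [this]
      nlinarith [sq_nonneg (y * Real.sin θ + (ζ.re - s) * Real.cos θ)]
    linarith
  have hc : Real.cos ζ.arg * ‖ζ‖ = ζ.re := by
    rw [Complex.cos_arg hne, div_mul_cancel₀ _ hnorm.ne']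
  have hsn : Real.sin ζ.arg * ‖ζ‖ = ζ.im := by
    rw [Complex.sin_arg, div_mul_cancel₀ _ hnorm.ne']
  have harg := abs_lt.1 (Complex.abs_arg_lt_pi_div_two_iff.2 (Or.inl hre))
  refine ⟨hne, abs_lt.2 ⟨?_, ?_⟩⟩
  · by_contra! h
    have h1 : 0 ≤ Real.sin (-ζ.arg - θ) :=
      Real.sin_nonneg_of_nonneg_of_le_pi (by linarith) (by linarith [harg.1])
    rw [Real.sin_sub, Real.sin_neg, Real.cos_neg] at h1
    have h2 := key (-ζ.im) (by ring)
    rw [← hc, ← hsn] at h2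
    nlinarith
  · by_contra! h
    have h1 : 0 ≤ Real.sin (ζ.arg - θ) :=
      Real.sin_nonneg_of_nonneg_of_le_pi (by linarith) (by linarith [harg.2])
    rw [Real.sin_sub] at h1
    have h2 := key ζ.im rfl
    rw [← hc, ← hsn] at h2
    nlinarith

/-- If a holomorphic function on the sector is bounded by `C` on every disc of radius `ρ`
centred on a real interval, then it is `C / ρ`-Lipschitz on that interval. -/
theorem norm_sub_le_of_forall_closedBall {F : ℂ → ℂ} {U : Set ℂ} {C ρ p q : ℝ} (hρ : 0 < ρ)
    (hF : DifferentiableOn ℂ F U)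
    (hU : ∀ s ∈ Set.Icc p q, Metric.closedBall (s : ℂ) ρ ⊆ U)
    (hC : ∀ s ∈ Set.Icc p q, ∀ ζ ∈ Metric.closedBall (s : ℂ) ρ, ‖F ζ‖ ≤ C)
    {x y : ℝ} (hx : x ∈ Set.Icc p q) (hy : y ∈ Set.Icc p q) :
    ‖F (y : ℂ) - F (x : ℂ)‖ ≤ C / ρ * |y - x| := by
  have hconv : Convex ℝ (Complex.ofRealCLM '' Set.Icc p q) :=
    (convex_Icc p q).linear_image Complex.ofRealCLM.toLinearMap
  have h := hconv.norm_image_sub_le_of_norm_deriv_le (𝕜 := ℂ) (f := F) (C := C / ρ) ?_ ?_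
    (Set.mem_image_of_mem _ hx) (Set.mem_image_of_mem _ hy)
  · simpa only [Complex.ofRealCLM_apply, ← Complex.ofReal_sub, Complex.norm_real,
      Real.norm_eq_abs] using h
  · rintro _ ⟨s, hs, rfl⟩
    exact hF.differentiableAt
      (Filter.mem_of_superset (Metric.closedBall_mem_nhds _ hρ) (hU s hs))
  · rintro _ ⟨s, hs, rfl⟩
    exact Complex.norm_deriv_le_of_forall_mem_sphere_norm_le hρ
      (hF.diffContOnCl_ball (hU s hs))
      fun ζ hζ => hC s hs ζ (Metric.sphere_subset_closedBall hζ)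

/-- **Cauchy–Duhamel time-regularity estimate.**  If `F` is holomorphic on the
sector `Δ(θ)` and satisfies `|F(ζ)| ≤ a|ζ|^{−d/2} e^{ω|ζ|} e^{−br²/|ζ|}` there,
then there are `a', b' > 0` and `ω' ≥ 0`, depending only on `a`, `b`, `d`, `θ`
and `ω` (not on `r`, `t` or `t'`), with
`|F(t−t') − F(t)| ≤ a'|t'| t^{−1−d/2} e^{ω' t} e^{−b'r²/t}` for all `t > 0` and
`|t'| ≤ t/2`. -/
theorem sector_holomorphic_time_regularity (θ a b ω : ℝ) (d : ℕ)
    (hθ₀ : 0 < θ) (hθ : θ < π / 2) (ha : 0 < a) (hb : 0 < b) (hω : 0 ≤ ω)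
    (hd : 1 ≤ d) :
    ∃ a' b' ω' : ℝ, 0 < a' ∧ 0 < b' ∧ 0 ≤ ω' ∧
      ∀ r : ℝ, 0 ≤ r → ∀ F : ℂ → ℂ,
        DifferentiableOn ℂ F (sector θ) →
        (∀ ζ : ℂ, ζ ∈ sector θ →
          ‖F ζ‖ ≤ a * ‖ζ‖ ^ (-(d : ℝ) / 2) * Real.exp (ω * ‖ζ‖)
            * Real.exp (-b * r ^ 2 / ‖ζ‖)) →
        ∀ t t' : ℝ, 0 < t → |t'| ≤ t / 2 →
          ‖F ((t : ℂ) - (t' : ℂ)) - F (t : ℂ)‖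
            ≤ a' * |t'| * t ^ (-1 - (d : ℝ) / 2) * Real.exp (ω' * t)
              * Real.exp (-b' * r ^ 2 / t) := by
  have hsin : 0 < Real.sin θ := Real.sin_pos_of_pos_of_lt_pi hθ₀ (by linarith)
  have hsin1 := Real.sin_le_one θ
  refine ⟨a * (1 / 4) ^ (-(d : ℝ) / 2) / (Real.sin θ / 4), b / 2, 2 * ω, by positivity,
    by positivity, by positivity, ?_⟩
  intro r hr F hF hbound t t' ht ht'
  obtain ⟨h1, h2⟩ := abs_le.1 ht'
  have hball : ∀ s ∈ Set.Icc (t / 2) (3 * t / 2),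
      ∀ ζ ∈ Metric.closedBall (s : ℂ) (t * (Real.sin θ / 4)),
        ζ ∈ sector θ ∧ t / 4 ≤ ‖ζ‖ ∧ ‖ζ‖ ≤ 2 * t := by
    rintro s ⟨hs1, hs2⟩ ζ hζ
    rw [Metric.mem_closedBall, dist_eq_norm] at hζ
    have hs : 0 < s := by linarith
    have hns : ‖(s : ℂ)‖ = s := by rw [Complex.norm_real, Real.norm_of_nonneg hs.le]
    have h3 := abs_le.1 (abs_norm_sub_norm_le ζ (s : ℂ))
    rw [hns] at h3
    refine ⟨mem_sector_of_norm_sub_lt hθ₀ hθ hs ?_, ?_, ?_⟩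
    · nlinarith
    · nlinarith [h3.1]
    · nlinarith [h3.2]
  have h := norm_sub_le_of_forall_closedBall (F := F) (U := sector θ)
    (C := a * (t / 4) ^ (-(d : ℝ) / 2) * Real.exp (ω * (2 * t)) * Real.exp (-b * r ^ 2 / (2 * t)))
    (ρ := t * (Real.sin θ / 4)) (p := t / 2) (q := 3 * t / 2) (x := t) (y := t - t')
    (by positivity) hF (fun s hs ζ hζ => (hball s hs ζ hζ).1) ?_
    ⟨by linarith, by linarith⟩ ⟨by linarith, by linarith⟩
  · rw [Complex.ofReal_sub] at h
    refine h.trans_eq ?_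
    have e1 : |t - t' - t| = |t'| := by rw [← abs_neg]; ring_nf
    have e2 : (t / 4) ^ (-(d : ℝ) / 2)
        = (1 / 4) ^ (-(d : ℝ) / 2) * (t ^ (-1 - (d : ℝ) / 2) * t) := by
      rw [← Real.rpow_add_one ht.ne', div_eq_mul_one_div, mul_comm t,
        Real.mul_rpow (by norm_num) ht.le]
      ring_nf
    have e3 : -b * r ^ 2 / (2 * t) = -(b / 2) * r ^ 2 / t := by field_simp
    rw [e1, e2, e3, show ω * (2 * t) = 2 * ω * t by ring]
    field_simp
  · intro s hs ζ hζ
    obtain ⟨hm, hl, hu⟩ := hball s hs ζ hζ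
    have hpos : 0 < ‖ζ‖ := by linarith
    refine (hbound ζ hm).trans ?_
    have e1 : ‖ζ‖ ^ (-(d : ℝ) / 2) ≤ (t / 4) ^ (-(d : ℝ) / 2) :=
      Real.rpow_le_rpow_of_nonpos (by positivity) hl
        (by rw [neg_div]; exact neg_nonpos.2 (by positivity))
    have e2 : -b * r ^ 2 / ‖ζ‖ ≤ -b * r ^ 2 / (2 * t) := by
      rw [neg_mul, neg_div, neg_div, neg_le_neg_iff]
      gcongr
    gcongr
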